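/- Let T' : (S × A → ℝ) → (S × A → ℝ) be any operator satisfying, for all Q : S × A → ℝ and all (s,a): (T Q)(s,a) − α (V_Q(s) − Q(s,a)) ≤ (T' Q)(s,a) ≤ (T Q)(s,a), where α ∈ [0,1). Then for every Q_0 : S × A → ℝ, defining Q_{k+1} = T' Q_k and V_k(s) = max_a Q_k(s,a), and for every state s and action a: liminf_{k→∞} [V_k(s) − Q_k(s,a)] ≥ V*(s) − Q*(s,a). -/

import Mathlib

open Filter Topology Finset

/-- Value function induced by a Q-function: `V_Q(s) = max_a Q(s,a)`. -/
noncomputable def Vof {S A : Type*} [Fintype A] [Nonempty A]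
    (Q : S → A → ℝ) (s : S) : ℝ := ⨆ a, Q s a

/-- Bellman optimality operator `(T Q)(s,a) = r(s,a) + γ Σ_{s'} P(s'|s,a) V_Q(s')`. -/
noncomputable def bellmanOp {S A : Type*} [Fintype S] [Fintype A] [Nonempty A]
    (P : S → A → S → ℝ) (r : S → A → ℝ) (γ : ℝ)
    (Q : S → A → ℝ) : S → A → ℝ :=
  fun s a => r s a + γ * ∑ s', P s a s' * Vof Q s'

/-- Advantage Learning operator `(T_AL Q)(s,a) = (T Q)(s,a) - α (V_Q(s) - Q(s,a))`. -/
noncomputable def alOp {S A : Type*} [Fintype S] [Fintype A] [Nonempty A]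
    (P : S → A → S → ℝ) (r : S → A → ℝ) (γ α : ℝ)
    (Q : S → A → ℝ) : S → A → ℝ :=
  fun s a => bellmanOp P r γ Q s a - α * (Vof Q s - Q s a)

/-- Clipped Advantage Learning operator. -/
noncomputable def clipOp {S A : Type*} [Fintype S] [Fintype A] [Nonempty A]
    (P : S → A → S → ℝ) (r : S → A → ℝ) (γ α c Ql : ℝ)
    (Q : S → A → ℝ) : S → A → ℝ :=
  fun s a => if Q s a - Ql ≥ c * (Vof Q s - Ql)
    then alOp P r γ α Q s a else bellmanOp P r γ Q s a

/-- Sup norm over a finite nonempty domain. -/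
noncomputable def supNorm {S : Type*} [Fintype S] [Nonempty S] (f : S → ℝ) : ℝ :=
  ⨆ s, |f s|

lemma Vof_ge {S A : Type*} [Fintype A] [Nonempty A] (Q : S → A → ℝ) (s : S) (a : A) :
    Q s a ≤ Vof Q s := le_ciSup (Set.finite_range (Q s)).bddAbove a

lemma Vof_att {S A : Type*} [Fintype A] [Nonempty A] (Q : S → A → ℝ) (s : S) :
    ∃ a, Q s a = Vof Q s := exists_eq_ciSup_of_finite

lemma avg_le {S : Type*} [Fintype S] (p f : S → ℝ) (hp : ∀ s, 0 ≤ p s) (h1 : ∑ s, p s = 1)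
    (c : ℝ) (hf : ∀ s, f s ≤ c) : ∑ s, p s * f s ≤ c := by
  calc ∑ s, p s * f s ≤ ∑ s, p s * c :=
        Finset.sum_le_sum fun s _ => mul_le_mul_of_nonneg_left (hf s) (hp s)
    _ = c := by rw [← Finset.sum_mul, h1, one_mul]

lemma le_avg {S : Type*} [Fintype S] (p f : S → ℝ) (hp : ∀ s, 0 ≤ p s) (h1 : ∑ s, p s = 1)
    (c : ℝ) (hf : ∀ s, c ≤ f s) : c ≤ ∑ s, p s * f s := by
  have := avg_le p (fun s => - f s) hp h1 (-c) (fun s => neg_le_neg (hf s))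
  simp only [mul_neg, Finset.sum_neg_distrib] at this
  linarith

lemma compare_aux {S A : Type*} [Fintype S] [Nonempty S]
    (P : S → A → S → ℝ) (hP0 : ∀ s a s', 0 ≤ P s a s')
    (hP1 : ∀ s a, ∑ s', P s a s' = 1)
    (r : S → A → ℝ) (γ : ℝ) (hγ0 : 0 ≤ γ) (hγ1 : γ < 1) (W U : S → ℝ)
    (hW : ∀ s, ∃ a, W s ≤ r s a + γ * ∑ s', P s a s' * W s')
    (hU : ∀ s a, r s a + γ * ∑ s', P s a s' * U s' ≤ U s) : ∀ s, W s ≤ U s := by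
  obtain ⟨s0, hs0⟩ := Finite.exists_max (fun s => W s - U s)
  obtain ⟨a, ha⟩ := hW s0
  have h1 := hU s0 a
  have h2 := avg_le (P s0 a) (fun s => W s - U s) (hP0 s0 a) (hP1 s0 a) _ hs0
  simp only [mul_sub, Finset.sum_sub_distrib] at h2
  have h3 := mul_le_mul_of_nonneg_left h2 hγ0
  have h4 : W s0 - U s0 ≤ 0 := by
    by_contra hc
    push Not at hc
    nlinarith
  intro s
  have := hs0 s
  linarith

lemma rec_bound (g : ℕ → ℝ) (α B : ℝ) (hα0 : 0 ≤ α) (hα1 : α < 1)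
    (h : ∀ k, g (k + 1) ≤ B + α * g k) : ∀ k, g k ≤ max (g 0) (B / (1 - α)) := by
  intro k
  induction k with
  | zero => exact le_max_left _ _
  | succ k ih =>
    have h1 : B / (1 - α) ≤ max (g 0) (B / (1 - α)) := le_max_right _ _
    rw [div_le_iff₀ (by linarith)] at h1
    have := mul_le_mul_of_nonneg_left ih hα0
    linarith [h k]

theorem stmt_6
    {S A : Type*} [Fintype S] [Nonempty S] [Fintype A] [Nonempty A]
    (P : S → A → S → ℝ) (hP0 : ∀ s a s', 0 ≤ P s a s')
    (hP1 : ∀ s a, ∑ s', P s a s' = 1)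
    (r : S → A → ℝ) (γ : ℝ) (hγ0 : 0 ≤ γ) (hγ1 : γ < 1)
    (Qstar : S → A → ℝ) (hQstar : bellmanOp P r γ Qstar = Qstar)
    (α : ℝ) (hα0 : 0 ≤ α) (hα1 : α < 1)
    (T' : (S → A → ℝ) → (S → A → ℝ))
    (hT' : ∀ Q s a,
      bellmanOp P r γ Q s a - α * (Vof Q s - Q s a) ≤ T' Q s a ∧
      T' Q s a ≤ bellmanOp P r γ Q s a)
    (Qseq : ℕ → S → A → ℝ)
    (hQseq : ∀ k, Qseq (k + 1) = T' (Qseq k))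
 :
    ∀ (s : S) (a : A),
      Vof Qstar s - Qstar s a ≤
        Filter.liminf (fun k => Vof (Qseq k) s - Qseq k s a) atTop := by
  have hup : ∀ k s a, Qseq (k+1) s a ≤ bellmanOp P r γ (Qseq k) s a := fun k s a => by
    rw [hQseq]; exact (hT' _ s a).2
  have hlo : ∀ k s a, bellmanOp P r γ (Qseq k) s a - α * (Vof (Qseq k) s - Qseq k s a)
      ≤ Qseq (k+1) s a := fun k s a => by
    rw [hQseq]; exact (hT' _ s a).1
  -- upper bound
  have hbdd : ∃ M, ∀ k s, Vof (Qseq k) s ≤ M := by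
    obtain ⟨R, hR⟩ : ∃ R, ∀ s a, r s a ≤ R := by
      obtain ⟨p, hp⟩ := Finite.exists_max (fun p : S × A => r p.1 p.2)
      exact ⟨_, fun s a => hp (s, a)⟩
    obtain ⟨s0, hs0⟩ := Finite.exists_max (fun s => Vof (Qseq 0) s)
    refine ⟨max (Vof (Qseq 0) s0) (R / (1 - γ)), fun k => ?_⟩
    induction k with
    | zero => exact fun s => (hs0 s).trans (le_max_left _ _)
    | succ k ih =>
      intro s
      obtain ⟨a, ha⟩ := Vof_att (Qseq (k+1)) s
      have h1 := hup k s a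
      have h2 := mul_le_mul_of_nonneg_left (avg_le (P s a) _ (hP0 s a) (hP1 s a) _ ih) hγ0
      have h3 : R / (1 - γ) ≤ max (Vof (Qseq 0) s0) (R / (1 - γ)) := le_max_right _ _
      rw [div_le_iff₀ (by linarith)] at h3
      have h4 := hR s a
      unfold bellmanOp at h1
      linarith
  obtain ⟨M, hM⟩ := hbdd
  -- almost monotone
  have hD : ∃ C, 0 ≤ C ∧ ∀ k s, -(C * γ ^ k) ≤ Vof (Qseq (k+1)) s - Vof (Qseq k) s := by
    obtain ⟨s0, hs0⟩ := Finite.exists_min (fun s => Vof (Qseq 1) s - Vof (Qseq 0) s)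
    refine ⟨|Vof (Qseq 1) s0 - Vof (Qseq 0) s0|, abs_nonneg _, fun k => ?_⟩
    induction k with
    | zero =>
      intro s
      have h1 := hs0 s
      have h2 := neg_abs_le (Vof (Qseq 1) s0 - Vof (Qseq 0) s0)
      simp only [pow_zero, mul_one, zero_add] at h1 ⊢
      linarith
    | succ k ih =>
      intro s
      obtain ⟨a, ha⟩ := Vof_att (Qseq (k+1)) s
      have h1 := hup k s a
      have h2 := hlo (k+1) s a
      have h3 := mul_le_mul_of_nonneg_left (le_avg (P s a) _ (hP0 s a) (hP1 s a) _ ih) hγ0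
      simp only [mul_sub, Finset.sum_sub_distrib] at h3
      have h4 := Vof_ge (Qseq (k+1+1)) s a
      rw [ha] at h2
      unfold bellmanOp at h1 h2
      rw [pow_succ]
      linarith
  obtain ⟨C, hC, hD⟩ := hD
  have hconv : ∀ s, ∃ w, Tendsto (fun k => Vof (Qseq k) s) atTop (𝓝 w) := by
    intro s
    have hmono : Monotone (fun k => Vof (Qseq k) s - C / (1 - γ) * γ ^ k) := by
      refine monotone_nat_of_le_succ fun k => ?_
      have h1 := hD k s
      have h2 : C / (1 - γ) * γ ^ k - C / (1 - γ) * γ ^ (k+1) = C * γ ^ k := by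
        have : (1 - γ) ≠ 0 := by linarith
        field_simp
        ring
      linarith
    have hb : BddAbove (Set.range (fun k => Vof (Qseq k) s - C / (1 - γ) * γ ^ k)) := by
      refine ⟨M, ?_⟩
      rintro _ ⟨k, rfl⟩
      have h1 := hM k s
      have h2 : 0 ≤ C / (1 - γ) * γ ^ k :=
        mul_nonneg (div_nonneg hC (by linarith)) (pow_nonneg hγ0 k)
      simp only
      linarith
    have h1 := tendsto_atTop_ciSup hmono hb
    have h2 := (tendsto_pow_atTop_nhds_zero_of_lt_one hγ0 hγ1).const_mul (C / (1 - γ))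
    refine ⟨_, (h1.add h2).congr fun k => ?_⟩
    ring
  choose W hW using hconv
  have hTW : ∀ s a, Tendsto (fun k => bellmanOp P r γ (Qseq k) s a) atTop
      (𝓝 (r s a + γ * ∑ s', P s a s' * W s')) := by
    intro s a
    unfold bellmanOp
    exact ((tendsto_finsetSum _ fun s' _ => (hW s').const_mul _).const_mul _).const_add _
  have hb : ∀ s a, Tendsto (fun k => Vof (Qseq (k+1)) s - bellmanOp P r γ (Qseq k) s a) atTop
      (𝓝 (W s - (r s a + γ * ∑ s', P s a s' * W s'))) := fun s a =>
    ((tendsto_add_atTop_iff_nat 1).2 (hW s)).sub (hTW s a)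
  have hg0 : ∀ k s a, 0 ≤ Vof (Qseq k) s - Qseq k s a := fun k s a =>
    sub_nonneg.2 (Vof_ge _ _ _)
  -- gaps bounded
  have hgb : ∀ s a, ∃ G, ∀ k, Vof (Qseq k) s - Qseq k s a ≤ G := by
    intro s a
    obtain ⟨B, hB⟩ := (hb s a).bddAbove_range
    refine ⟨_, rec_bound (fun k => Vof (Qseq k) s - Qseq k s a) α B hα0 hα1 fun k => ?_⟩
    have h1 := hB ⟨k, rfl⟩
    have h2 := hlo k s a
    simp only at h1 ⊢
    linarith
  have hWge : ∀ s a, r s a + γ * ∑ s', P s a s' * W s' ≤ W s := by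
    intro s a
    by_contra hc
    push Not at hc
    obtain ⟨e, he, hlt⟩ : ∃ e : ℝ, 0 < e ∧ W s - (r s a + γ * ∑ s', P s a s' * W s') < -e :=
      ⟨-(W s - (r s a + γ * ∑ s', P s a s' * W s')) / 2, by linarith, by linarith⟩
    obtain ⟨N, hN⟩ := eventually_atTop.1 ((hb s a).eventually (gt_mem_nhds hlt))
    have hdec : ∀ n : ℕ, Vof (Qseq (N+n)) s - Qseq (N+n) s a
        ≤ (Vof (Qseq N) s - Qseq N s a) - n * e := by
      intro n
      induction n with
      | zero => simp
      | succ n ih =>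
        have h1 := hN (N+n) (by omega)
        have h2 := hlo (N+n) s a
        have h3 := hg0 (N+n) s a
        have h4 : α * (Vof (Qseq (N+n)) s - Qseq (N+n) s a) ≤
          1 * (Vof (Qseq (N+n)) s - Qseq (N+n) s a) :=
            mul_le_mul_of_nonneg_right hα1.le h3
        rw [← add_assoc]
        push_cast
        linarith
    obtain ⟨n, hn⟩ := exists_nat_gt ((Vof (Qseq N) s - Qseq N s a) / e)
    rw [div_lt_iff₀ he] at hn
    linarith [hdec n, hg0 (N+n) s a]
  have hWle : ∀ s, ∃ a, W s ≤ r s a + γ * ∑ s', P s a s' * W s' := by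
    intro s
    by_contra! hc
    have hev : ∀ᶠ k in atTop, ∀ a, 0 < Vof (Qseq (k+1)) s - bellmanOp P r γ (Qseq k) s a :=
      eventually_all.2 fun a => (hb s a).eventually (lt_mem_nhds (by linarith [hc a]))
    obtain ⟨k, hk⟩ := hev.exists
    obtain ⟨a, ha⟩ := Vof_att (Qseq (k+1)) s
    linarith [hk a, hup k s a]
  have hst : ∀ s a, r s a + γ * ∑ s', P s a s' * Vof Qstar s' = Qstar s a := fun s a =>
    congrFun (congrFun hQstar s) a
  have hWV : ∀ s, W s = Vof Qstar s := by
    intro s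
    apply le_antisymm
    · exact compare_aux P hP0 hP1 r γ hγ0 hγ1 W (Vof Qstar) hWle
        (fun s a => by rw [hst]; exact Vof_ge _ _ _) s
    · refine compare_aux P hP0 hP1 r γ hγ0 hγ1 (Vof Qstar) W (fun s => ?_) hWge s
      obtain ⟨a, ha⟩ := Vof_att Qstar s
      exact ⟨a, by rw [hst, ha]⟩
  intro s a
  have hlim := hb s a
  simp only [hWV, hst] at hlim
  rw [← Filter.liminf_nat_add (fun k => Vof (Qseq k) s - Qseq k s a) 1, ← hlim.liminf_eq]
  obtain ⟨G, hG⟩ := hgb s a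
  refine liminf_le_liminf (Eventually.of_forall fun k => ?_) hlim.isBoundedUnder_ge ?_
  · have := hup k s a
    linarith
  · exact (isBoundedUnder_of ⟨G, fun k => hG (k+1)⟩ :
      IsBoundedUnder (· ≤ ·) atTop _).isCoboundedUnder_ge
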